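/- arXiv:2502.19792 — 2 statements merged into one kernel-verified Lean document; each statement's English description precedes it below -/
import Mathlib

section
/- Let 𝔅 be nonsingular, b ∈ ℝ^l, w = [x; y; z] = 𝔅^{-1}b, L ∈ ℝ^{k×l}, and let Ψ, χ, ξ be positive real numbers. For ε > 0 let S(ε) be the supremum of ‖L(𝔅+Δ𝔅)^{-1}(b+Δb) − L𝔅^{-1}b‖₂ / ( ξ · ‖[vec(ΔA)/Ψ; vec(ΔB)/Ψ; vec(ΔC)/Ψ; vec(ΔD)/Ψ; vec(ΔE)/Ψ; Δb/χ]‖₂ ) over all perturbations ΔA ∈ ℝ^{n×n}, ΔB ∈ ℝ^{m×n}, ΔC ∈ ℝ^{p×m}, ΔD ∈ ℝ^{m×m}, ΔE ∈ ℝ^{p×p}, Δb ∈ ℝ^l for which Δ𝔅 = [[ΔA, ΔBᵀ, 0],[ΔB, −ΔD, ΔCᵀ],[0, ΔC, ΔE]] makes 𝔅+Δ𝔅 nonsingular and the perturbation measure ‖[vec(ΔA)/Ψ; …; vec(ΔE)/Ψ; Δb/χ]‖₂ lies in (0, ε]. Then S(ε) tends, as ε → 0⁺, to ‖L·𝔅^{-1}·[Ψ·𝒢,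 −χ·I_l]‖₂ / ξ, where ‖·‖₂ denotes the spectral norm. -/
open Matrix Filter Topology

noncomputable section

/-- Index type for block vectors of sizes `n, m, p` (the paper's `l = n + m + p`). -/
abbrev Idx (n m p : ℕ) := Fin n ⊕ (Fin m ⊕ Fin p)

/-- Index type for the stacked vector `[vec A; vec B; vec C; vec D; vec E]`
(the paper's `s = n² + nm + mp + m² + p²`). -/
abbrev GIdx (n m p : ℕ) :=
  (Fin n × Fin n) ⊕ ((Fin n × Fin m) ⊕ ((Fin m × Fin p) ⊕ ((Fin m × Fin m) ⊕ (Fin p × Fin p))))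

/-- Column-stacking vectorization of a `q × r` matrix: `vecC X (j, i) = X i j`
(index = (column, row)). -/
def vecC {q r : ℕ} (X : Matrix (Fin q) (Fin r) ℝ) : Fin r × Fin q → ℝ := fun c => X c.2 c.1

/-- The double saddle point block matrix `[[A, Bᵀ, 0], [B, -D, Cᵀ], [0, C, E]]`. -/
def dsp {n m p : ℕ} (A : Matrix (Fin n) (Fin n) ℝ) (B : Matrix (Fin m) (Fin n) ℝ)
    (C : Matrix (Fin p) (Fin m) ℝ) (D : Matrix (Fin m) (Fin m) ℝ)
    (E : Matrix (Fin p) (Fin p) ℝ) : Matrix (Idx n m p) (Idx n m p) ℝ :=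
  Matrix.of fun i j =>
    match i, j with
    | Sum.inl i, Sum.inl j => A i j
    | Sum.inl i, Sum.inr (Sum.inl j) => Bᵀ i j
    | Sum.inl _, Sum.inr (Sum.inr _) => 0
    | Sum.inr (Sum.inl i), Sum.inl j => B i j
    | Sum.inr (Sum.inl i), Sum.inr (Sum.inl j) => -D i j
    | Sum.inr (Sum.inl i), Sum.inr (Sum.inr j) => Cᵀ i j
    | Sum.inr (Sum.inr _), Sum.inl _ => 0
    | Sum.inr (Sum.inr i), Sum.inr (Sum.inl j) => C i j
    | Sum.inr (Sum.inr i), Sum.inr (Sum.inr j) => E i j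

/-- The matrix `𝒢 = [[xᵀ⊗Iₙ, Iₙ⊗yᵀ, 0, 0, 0], [0, xᵀ⊗Iₘ, Iₘ⊗zᵀ, -(yᵀ⊗Iₘ), 0],
[0, 0, yᵀ⊗Iₚ, 0, zᵀ⊗Iₚ]] ∈ ℝ^{l×s}`, written entrywise with respect to the
column-stacking indices (so that `𝒢 ·ᵥ [vec ΔA; vec ΔB; vec ΔC; vec ΔD; vec ΔE]`
is exactly the action of the Kronecker-product block matrix of the paper). -/
def calG {n m p : ℕ} (x : Fin n → ℝ) (y : Fin m → ℝ) (z : Fin p → ℝ) :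
    Matrix (Idx n m p) (GIdx n m p) ℝ :=
  Matrix.of fun i c =>
    match i, c with
    | Sum.inl i, Sum.inl (j, i') => x j * (if i = i' then 1 else 0)
    | Sum.inl i, Sum.inr (Sum.inl (j, i')) => (if i = j then 1 else 0) * y i'
    | Sum.inl _, Sum.inr (Sum.inr (Sum.inl _)) => 0
    | Sum.inl _, Sum.inr (Sum.inr (Sum.inr (Sum.inl _))) => 0
    | Sum.inl _, Sum.inr (Sum.inr (Sum.inr (Sum.inr _))) => 0
    | Sum.inr (Sum.inl _), Sum.inl _ => 0
    | Sum.inr (Sum.inl i), Sum.inr (Sum.inl (j, i')) => x j * (if i = i' then 1 else 0)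
    | Sum.inr (Sum.inl i), Sum.inr (Sum.inr (Sum.inl (j, i'))) => (if i = j then 1 else 0) * z i'
    | Sum.inr (Sum.inl i), Sum.inr (Sum.inr (Sum.inr (Sum.inl (j, i')))) =>
        -(y j * (if i = i' then 1 else 0))
    | Sum.inr (Sum.inl _), Sum.inr (Sum.inr (Sum.inr (Sum.inr _))) => 0
    | Sum.inr (Sum.inr _), Sum.inl _ => 0
    | Sum.inr (Sum.inr _), Sum.inr (Sum.inl _) => 0
    | Sum.inr (Sum.inr i), Sum.inr (Sum.inr (Sum.inl (j, i'))) => y j * (if i = i' then 1 else 0)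
    | Sum.inr (Sum.inr _), Sum.inr (Sum.inr (Sum.inr (Sum.inl _))) => 0
    | Sum.inr (Sum.inr i), Sum.inr (Sum.inr (Sum.inr (Sum.inr (j, i')))) =>
        z j * (if i = i' then 1 else 0)

/-- The stacked vector `[vec A; vec B; vec C; vec D; vec E]`. -/
def vecG {n m p : ℕ} (A : Matrix (Fin n) (Fin n) ℝ) (B : Matrix (Fin m) (Fin n) ℝ)
    (C : Matrix (Fin p) (Fin m) ℝ) (D : Matrix (Fin m) (Fin m) ℝ)
    (E : Matrix (Fin p) (Fin p) ℝ) : GIdx n m p → ℝ :=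
  Sum.elim (vecC A) (Sum.elim (vecC B) (Sum.elim (vecC C) (Sum.elim (vecC D) (vecC E))))

/-- Euclidean norm of a vector. -/
def euclNorm {ι : Type*} [Fintype ι] (v : ι → ℝ) : ℝ := Real.sqrt (∑ i, v i ^ 2)

/-- Spectral norm (largest singular value = induced 2-norm) of a real matrix. -/
def specNorm {a b : Type*} [Fintype a] [Fintype b] (M : Matrix a b ℝ) : ℝ :=
  sSup {r : ℝ | ∃ v : b → ℝ, euclNorm v = 1 ∧ r = euclNorm (M.mulVec v)}

/-- Max-norm (`‖·‖_∞`) of a vector. -/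
def infNormV {ι : Type*} [Fintype ι] (v : ι → ℝ) : ℝ := ⨆ i, |v i|

/-- Induced ∞-norm of a matrix: the maximum absolute row sum. -/
def infNormM {a b : Type*} [Fintype a] [Fintype b] (M : Matrix a b ℝ) : ℝ :=
  ⨆ i, ∑ j, |M i j|

/-- Horizontal (block-column) concatenation `[M, N]`. -/
def hcat {a b c : Type*} (M : Matrix a b ℝ) (N : Matrix a c ℝ) : Matrix a (b ⊕ c) ℝ :=
  Matrix.of fun i => Sum.elim (M i) (N i)

/-- Entrywise absolute value of a matrix. -/
def absM {a b : Type*} (M : Matrix a b ℝ) : Matrix a b ℝ := Matrix.of fun i j => |M i j|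

/-- Entrywise absolute value of a vector. -/
def absV {ι : Type*} (v : ι → ℝ) : ι → ℝ := fun i => |v i|

/-- The matrix `𝒥 = [[(‖x‖₂²+‖y‖₂²)Iₙ, xyᵀ, 0], [yxᵀ, (‖x‖₂²+‖y‖₂²+‖z‖₂²)Iₘ, yzᵀ],
[0, zyᵀ, (‖y‖₂²+‖z‖₂²)Iₚ]]`. -/
def calJ {n m p : ℕ} (x : Fin n → ℝ) (y : Fin m → ℝ) (z : Fin p → ℝ) :
    Matrix (Idx n m p) (Idx n m p) ℝ :=
  Matrix.of fun i j =>
    match i, j with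
    | Sum.inl i, Sum.inl j => (euclNorm x ^ 2 + euclNorm y ^ 2) * (if i = j then 1 else 0)
    | Sum.inl i, Sum.inr (Sum.inl j) => x i * y j
    | Sum.inl _, Sum.inr (Sum.inr _) => 0
    | Sum.inr (Sum.inl i), Sum.inl j => y i * x j
    | Sum.inr (Sum.inl i), Sum.inr (Sum.inl j) =>
        (euclNorm x ^ 2 + euclNorm y ^ 2 + euclNorm z ^ 2) * (if i = j then 1 else 0)
    | Sum.inr (Sum.inl i), Sum.inr (Sum.inr j) => y i * z j
    | Sum.inr (Sum.inr _), Sum.inl _ => 0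
    | Sum.inr (Sum.inr i), Sum.inr (Sum.inl j) => z i * y j
    | Sum.inr (Sum.inr i), Sum.inr (Sum.inr j) =>
        (euclNorm y ^ 2 + euclNorm z ^ 2) * (if i = j then 1 else 0)

/-- The scaled perturbation vector
`[vec(Ψ_A‡⊙ΔA); vec(Ψ_B‡⊙ΔB); vec(Ψ_C‡⊙ΔC); vec(Ψ_D‡⊙ΔD); vec(Ψ_E‡⊙ΔE); χ‡⊙Δb]`
(for data with all entries nonzero, `v‡` is the entrywise reciprocal). -/
def scaledPert {n m p : ℕ} (ΨA : Matrix (Fin n) (Fin n) ℝ) (ΨB : Matrix (Fin m) (Fin n) ℝ)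
    (ΨC : Matrix (Fin p) (Fin m) ℝ) (ΨD : Matrix (Fin m) (Fin m) ℝ)
    (ΨE : Matrix (Fin p) (Fin p) ℝ) (χ : Idx n m p → ℝ)
    (ΔA : Matrix (Fin n) (Fin n) ℝ) (ΔB : Matrix (Fin m) (Fin n) ℝ)
    (ΔC : Matrix (Fin p) (Fin m) ℝ) (ΔD : Matrix (Fin m) (Fin m) ℝ)
    (ΔE : Matrix (Fin p) (Fin p) ℝ) (Δb : Idx n m p → ℝ) : GIdx n m p ⊕ Idx n m p → ℝ :=
  Sum.elim (fun c => (vecG ΨA ΨB ΨC ΨD ΨE c)⁻¹ * vecG ΔA ΔB ΔC ΔD ΔE c)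
    (fun i => (χ i)⁻¹ * Δb i)

/-- The vector `ℋ = [|A||x| + |B|ᵀ|y|; |B||x| + |D||y| + |C|ᵀ|z|; |C||y| + |E||z|]`. -/
def calH {n m p : ℕ} (A : Matrix (Fin n) (Fin n) ℝ) (B : Matrix (Fin m) (Fin n) ℝ)
    (C : Matrix (Fin p) (Fin m) ℝ) (D : Matrix (Fin m) (Fin m) ℝ)
    (E : Matrix (Fin p) (Fin p) ℝ) (x : Fin n → ℝ) (y : Fin m → ℝ) (z : Fin p → ℝ) :
    Idx n m p → ℝ :=
  Sum.elim ((absM A).mulVec (absV x) + (absM B)ᵀ.mulVec (absV y))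
    (Sum.elim
      ((absM B).mulVec (absV x) + (absM D).mulVec (absV y) + (absM C)ᵀ.mulVec (absV z))
      ((absM C).mulVec (absV y) + (absM E).mulVec (absV z)))

/-- Index type of the structured (generating-vector) parameter space
`[a; vec B; vec C; d; e]`. -/
abbrev SIdx (n m p s₁ r q : ℕ) :=
  Fin s₁ ⊕ (((Fin n × Fin m) ⊕ (Fin m × Fin p)) ⊕ (Fin r ⊕ Fin q))

/-- `Φ_S = blkdiag(Φ₁, I_{nm+mp}, Φ₂, Φ₃)`. -/
def PhiS {n m p s₁ r q : ℕ} (Φ₁ : Matrix (Fin n × Fin n) (Fin s₁) ℝ)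
    (Φ₂ : Matrix (Fin m × Fin m) (Fin r) ℝ) (Φ₃ : Matrix (Fin p × Fin p) (Fin q) ℝ) :
    Matrix (GIdx n m p) (SIdx n m p s₁ r q) ℝ :=
  Matrix.of fun i j =>
    match i, j with
    | Sum.inl i, Sum.inl j => Φ₁ i j
    | Sum.inr (Sum.inl i), Sum.inr (Sum.inl (Sum.inl j)) => if i = j then 1 else 0
    | Sum.inr (Sum.inr (Sum.inl i)), Sum.inr (Sum.inl (Sum.inr j)) => if i = j then 1 else 0
    | Sum.inr (Sum.inr (Sum.inr (Sum.inl i))), Sum.inr (Sum.inr (Sum.inl j)) => Φ₂ i j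
    | Sum.inr (Sum.inr (Sum.inr (Sum.inr i))), Sum.inr (Sum.inr (Sum.inr j)) => Φ₃ i j
    | _, _ => 0

/-- The structured scaled perturbation vector
`[ψ_A‡⊙Δa; vec(Ψ_B‡⊙ΔB); vec(Ψ_C‡⊙ΔC); ψ_D‡⊙Δd; ψ_E‡⊙Δe; χ‡⊙Δb]`. -/
def structPert {n m p s₁ r q : ℕ} (ψA : Fin s₁ → ℝ) (ΨB : Matrix (Fin m) (Fin n) ℝ)
    (ΨC : Matrix (Fin p) (Fin m) ℝ) (ψD : Fin r → ℝ) (ψE : Fin q → ℝ) (χ : Idx n m p → ℝ)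
    (Δa : Fin s₁ → ℝ) (ΔB : Matrix (Fin m) (Fin n) ℝ) (ΔC : Matrix (Fin p) (Fin m) ℝ)
    (Δd : Fin r → ℝ) (Δe : Fin q → ℝ) (Δb : Idx n m p → ℝ) :
    SIdx n m p s₁ r q ⊕ Idx n m p → ℝ :=
  Sum.elim
    (Sum.elim (fun j => (ψA j)⁻¹ * Δa j)
      (Sum.elim
        (Sum.elim (fun c => (vecC ΨB c)⁻¹ * vecC ΔB c) (fun c => (vecC ΨC c)⁻¹ * vecC ΔC c))
        (Sum.elim (fun j => (ψD j)⁻¹ * Δd j) (fun j => (ψE j)⁻¹ * Δe j))))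
    (fun i => (χ i)⁻¹ * Δb i)

/-- The EILS augmented matrix `𝔅̂ = [[0, 0, C], [0, J, M], [Cᵀ, Mᵀ, 0]]`
(block sizes `p, n, m`). -/
def eilsAug {n m p : ℕ} (J : Matrix (Fin n) (Fin n) ℝ) (M : Matrix (Fin n) (Fin m) ℝ)
    (C : Matrix (Fin p) (Fin m) ℝ) :
    Matrix (Fin p ⊕ (Fin n ⊕ Fin m)) (Fin p ⊕ (Fin n ⊕ Fin m)) ℝ :=
  Matrix.of fun i j =>
    match i, j with
    | Sum.inl i, Sum.inr (Sum.inr j) => C i j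
    | Sum.inr (Sum.inl i), Sum.inr (Sum.inl j) => J i j
    | Sum.inr (Sum.inl i), Sum.inr (Sum.inr j) => M i j
    | Sum.inr (Sum.inr i), Sum.inl j => Cᵀ i j
    | Sum.inr (Sum.inr i), Sum.inr (Sum.inl j) => Mᵀ i j
    | _, _ => 0

/-- The block permutation matrix `Σ = [[0, Iₙ, 0], [0, 0, Iₘ], [I_p, 0, 0]]`
(block rows of sizes `n, m, p`; block columns of sizes `p, n, m`). -/
def sigmaPerm (n m p : ℕ) : Matrix (Idx n m p) (Fin p ⊕ (Fin n ⊕ Fin m)) ℝ :=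
  Matrix.of fun i j =>
    match i, j with
    | Sum.inl i, Sum.inr (Sum.inl j) => if i = j then 1 else 0
    | Sum.inr (Sum.inl i), Sum.inr (Sum.inr j) => if i = j then 1 else 0
    | Sum.inr (Sum.inr i), Sum.inl j => if i = j then 1 else 0
    | _, _ => 0

/-- The matrix `𝒢̂ = [[yᵀ⊗Iₙ, 0], [Iₘ⊗xᵀ, Iₘ⊗zᵀ], [0, yᵀ⊗I_p]] ∈ ℝ^{l×m(n+p)}`,
written entrywise with respect to column-stacking indices of `[vec(ΔBᵀ); vec(ΔC)]`. -/
def hatG {n m p : ℕ} (x : Fin n → ℝ) (y : Fin m → ℝ) (z : Fin p → ℝ) :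
    Matrix (Idx n m p) ((Fin m × Fin n) ⊕ (Fin m × Fin p)) ℝ :=
  Matrix.of fun i c =>
    match i, c with
    | Sum.inl i, Sum.inl (j, i') => y j * (if i = i' then 1 else 0)
    | Sum.inl _, Sum.inr _ => 0
    | Sum.inr (Sum.inl i), Sum.inl (j, i') => (if i = j then 1 else 0) * x i'
    | Sum.inr (Sum.inl i), Sum.inr (j, i') => (if i = j then 1 else 0) * z i'
    | Sum.inr (Sum.inr _), Sum.inl _ => 0
    | Sum.inr (Sum.inr i), Sum.inr (j, i') => y j * (if i = i' then 1 else 0)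

section EuclideanNorm

variable {ι κ : Type*} [Fintype ι] [Fintype κ]

lemma euclNorm_eq_norm (v : ι → ℝ) : euclNorm v = ‖WithLp.toLp 2 v‖ := by
  simp [euclNorm, EuclideanSpace.norm_eq]

lemma euclNorm_nonneg (v : ι → ℝ) : 0 ≤ euclNorm v := Real.sqrt_nonneg _

lemma euclNorm_smul (c : ℝ) (v : ι → ℝ) : euclNorm (c • v) = |c| * euclNorm v := by
  rw [euclNorm_eq_norm, euclNorm_eq_norm, WithLp.toLp_smul, norm_smul, Real.norm_eq_abs]

lemma euclNorm_neg (v : ι → ℝ) : euclNorm (-v) = euclNorm v := by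
  simp [euclNorm]

lemma euclNorm_add_le (v w : ι → ℝ) : euclNorm (v + w) ≤ euclNorm v + euclNorm w := by
  simp only [euclNorm_eq_norm, WithLp.toLp_add]
  exact norm_add_le _ _

lemma norm_le_euclNorm (v : ι → ℝ) : ‖v‖ ≤ euclNorm v := by
  refine (pi_norm_le_iff_of_nonneg (euclNorm_nonneg v)).2 fun i => ?_
  rw [euclNorm_eq_norm]
  exact PiLp.norm_apply_le (WithLp.toLp 2 v) i

open scoped Matrix.Norms.L2Operator in
lemma euclNorm_mulVec_le [DecidableEq ι] (M : Matrix κ ι ℝ) (v : ι → ℝ) :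
    euclNorm (M *ᵥ v) ≤ ‖M‖ * euclNorm v := by
  rw [euclNorm_eq_norm, euclNorm_eq_norm]
  exact M.l2_opNorm_mulVec (WithLp.toLp 2 v)

lemma bddAbove_specNorm_set (M : Matrix κ ι ℝ) :
    BddAbove {r : ℝ | ∃ v : ι → ℝ, euclNorm v = 1 ∧ r = euclNorm (M *ᵥ v)} := by
  classical
  open scoped Matrix.Norms.L2Operator in
  refine ⟨‖M‖, ?_⟩
  rintro r ⟨v, hv, rfl⟩
  simpa [hv] using euclNorm_mulVec_le M v

lemma euclNorm_mulVec_le_specNorm (M : Matrix κ ι ℝ) (v : ι → ℝ) (hv : euclNorm v = 1) :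
    euclNorm (M *ᵥ v) ≤ specNorm M :=
  le_csSup (bddAbove_specNorm_set M) ⟨v, hv, rfl⟩

lemma exists_euclNorm_eq_one [Nonempty ι] : ∃ v : ι → ℝ, euclNorm v = 1 := by
  classical
  obtain ⟨i⟩ := ‹Nonempty ι›
  exact ⟨Pi.single i 1, by rw [euclNorm_eq_norm]; simp⟩

lemma eventually_forall_euclNorm_le {P : (ι → ℝ) → Prop} (hP : ∀ᶠ u in 𝓝 0, P u) :
    ∀ᶠ ε : ℝ in 𝓝[>] 0, ∀ u, euclNorm u ≤ ε → P u := by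
  obtain ⟨δ, hδ, h⟩ := Metric.eventually_nhds_iff.1 hP
  filter_upwards [Ioo_mem_nhdsGT hδ] with ε hε u hu
  exact h (by simpa using (norm_le_euclNorm u).trans_lt (hu.trans_lt hε.2))

lemma eventually_euclNorm_mulVec_sub_le {X : Type*} [TopologicalSpace X]
    {F : X → Matrix κ ι ℝ} {a : X} (hF : ContinuousAt F a) {η : ℝ} (hη : 0 < η) :
    ∀ᶠ u in 𝓝 a, ∀ v, euclNorm ((F u - F a) *ᵥ v) ≤ η * euclNorm v := by
  classical
  open scoped Matrix.Norms.L2Operator in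
  have h : ∀ᶠ u in 𝓝 a, ‖F u - F a‖ < η := by
    have := Metric.tendsto_nhds.1 hF.tendsto η hη
    filter_upwards [this] with u hu
    rwa [← dist_eq_norm]
  filter_upwards [h] with u hu v
  exact (euclNorm_mulVec_le _ v).trans
    (mul_le_mul_of_nonneg_right hu.le (euclNorm_nonneg v))

/-- The supremum over small `u` of the gain `‖F u u‖ / (ξ ‖u‖)` of a matrix-valued map `F`,
continuous at the origin, tends to the scaled spectral norm of `F 0`. -/
lemma tendsto_sSup_euclNorm_mulVec_div {F : (ι → ℝ) → Matrix κ ι ℝ} (hF : ContinuousAt F 0)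
    {P : (ι → ℝ) → Prop} (hP : ∀ᶠ u in 𝓝 0, P u) {ξ : ℝ} (hξ : 0 < ξ) :
    Tendsto (fun ε : ℝ => sSup {t : ℝ | ∃ u, P u ∧ 0 < euclNorm u ∧ euclNorm u ≤ ε ∧
        t = euclNorm (F u *ᵥ u) / (ξ * euclNorm u)})
      (𝓝[>] 0) (𝓝 (specNorm (F 0) / ξ)) := by
  cases isEmpty_or_nonempty ι with
  | inl h => simp [specNorm, euclNorm]
  | inr h =>
  obtain ⟨e, he⟩ := exists_euclNorm_eq_one (ι := ι)
  refine Metric.tendsto_nhds.2 fun η hη => ?_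
  have hη' : 0 < η / 2 * ξ := by positivity
  filter_upwards [eventually_forall_euclNorm_le hP, self_mem_nhdsWithin,
    eventually_forall_euclNorm_le (eventually_euclNorm_mulVec_sub_le hF hη')] with ε hPε hε hFε
  replace hε : 0 < ε := hε
  set T := {t : ℝ | ∃ u, P u ∧ 0 < euclNorm u ∧ euclNorm u ≤ ε ∧
        t = euclNorm (F u *ᵥ u) / (ξ * euclNorm u)}
  -- the gain at a multiple of a unit vector
  have gain : ∀ (u v : ι → ℝ) (c : ℝ), 0 < c → u = c • v → euclNorm v = 1 →
      euclNorm (F u *ᵥ u) / (ξ * euclNorm u) = euclNorm (F u *ᵥ v) / ξ := by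
    rintro u v c hc huv hv
    have h1 : euclNorm u = c := by rw [huv, euclNorm_smul, hv, abs_of_pos hc, mul_one]
    have h2 : F u *ᵥ u = c • (F u *ᵥ v) := by conv_lhs => rw [huv, mulVec_smul, ← huv]
    rw [h1, h2, euclNorm_smul, abs_of_pos hc]
    field_simp
  have upper : ∀ t ∈ T, t ≤ specNorm (F 0) / ξ + η / 2 := by
    rintro t ⟨u, -, hu0, huε, rfl⟩
    have huv : u = euclNorm u • ((euclNorm u)⁻¹ • u) := by
      rw [smul_smul, mul_inv_cancel₀ hu0.ne', one_smul]
    have hv : euclNorm ((euclNorm u)⁻¹ • u) = 1 := by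
      rw [euclNorm_smul, abs_of_pos (inv_pos.2 hu0), inv_mul_cancel₀ hu0.ne']
    generalize (euclNorm u)⁻¹ • u = v at huv hv
    rw [gain u v _ hu0 huv hv, div_le_iff₀ hξ, add_mul, div_mul_cancel₀ _ hξ.ne']
    have h1 := hFε u huε v
    have h2 := euclNorm_mulVec_le_specNorm (F 0) v hv
    have h3 := euclNorm_add_le (F 0 *ᵥ v) ((F u - F 0) *ᵥ v)
    rw [← add_mulVec, add_sub_cancel] at h3
    rw [hv, mul_one] at h1
    linarith
  have lower : ∀ v : ι → ℝ, euclNorm v = 1 →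
      ∃ t ∈ T, euclNorm (F 0 *ᵥ v) / ξ ≤ t + η / 2 := by
    intro v hv
    have hu : euclNorm (ε • v) = ε := by rw [euclNorm_smul, hv, abs_of_pos hε, mul_one]
    refine ⟨_, ⟨ε • v, hPε _ hu.le, by rwa [hu], hu.le, rfl⟩, ?_⟩
    rw [gain _ v ε hε rfl hv, div_le_iff₀ hξ, add_mul, div_mul_cancel₀ _ hξ.ne']
    have h1 := hFε _ hu.le v
    have h3 := euclNorm_add_le (F (ε • v) *ᵥ v) (-((F (ε • v) - F 0) *ᵥ v))
    rw [euclNorm_neg, ← sub_eq_add_neg, ← sub_mulVec, sub_sub_cancel] at h3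
    rw [hv, mul_one] at h1
    linarith
  have hbdd : BddAbove T := ⟨_, upper⟩
  have h1 : sSup T ≤ specNorm (F 0) / ξ + η / 2 := by
    obtain ⟨t, ht, -⟩ := lower e he
    exact csSup_le ⟨t, ht⟩ upper
  have h2 : specNorm (F 0) ≤ (sSup T + η / 2) * ξ := by
    refine csSup_le ⟨_, e, he, rfl⟩ ?_
    rintro r ⟨v, hv, rfl⟩
    obtain ⟨t, ht, hvt⟩ := lower v hv
    have := le_csSup hbdd ht
    rw [← div_le_iff₀ hξ]
    linarith
  rw [← div_le_iff₀ hξ] at h2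
  rw [Real.dist_eq, abs_lt]
  constructor <;> linarith

end EuclideanNorm

lemma smul_div_cancel_of_pos {ι : Type*} {c : ℝ} (hc : 0 < c) (v : ι → ℝ) :
    (c • fun i => v i / c) = v := by
  ext i
  simp [mul_div_cancel₀ _ hc.ne']

section DoubleSaddlePoint

variable {n m p : ℕ}

lemma dsp_mulVec (A : Matrix (Fin n) (Fin n) ℝ) (B : Matrix (Fin m) (Fin n) ℝ)
    (C : Matrix (Fin p) (Fin m) ℝ) (D : Matrix (Fin m) (Fin m) ℝ)
    (E : Matrix (Fin p) (Fin p) ℝ) (x : Fin n → ℝ) (y : Fin m → ℝ) (z : Fin p → ℝ) :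
    dsp A B C D E *ᵥ Sum.elim x (Sum.elim y z) = calG x y z *ᵥ vecG A B C D E := by
  ext i
  rcases i with i | i | i <;>
    simp [dsp, calG, vecG, vecC, mulVec, dotProduct, Fintype.sum_sum_type,
      Fintype.sum_prod_type, mul_comm]
  exact add_comm _ _

lemma hcat_mulVec {a b c : Type*} [Fintype b] [Fintype c] (M : Matrix a b ℝ) (N : Matrix a c ℝ)
    (v : b → ℝ) (w : c → ℝ) : hcat M N *ᵥ Sum.elim v w = M *ᵥ v + N *ᵥ w := by
  ext i
  simp [hcat, mulVec, dotProduct, Fintype.sum_sum_type]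

/-- The double saddle point matrix whose stacked vector of blocks is `g`. -/
def dspOfVec (g : GIdx n m p → ℝ) : Matrix (Idx n m p) (Idx n m p) ℝ :=
  dsp (Matrix.of fun i j => g (.inl (j, i))) (Matrix.of fun i j => g (.inr (.inl (j, i))))
    (Matrix.of fun i j => g (.inr (.inr (.inl (j, i)))))
    (Matrix.of fun i j => g (.inr (.inr (.inr (.inl (j, i))))))
    (Matrix.of fun i j => g (.inr (.inr (.inr (.inr (j, i))))))

lemma dspOfVec_vecG (A : Matrix (Fin n) (Fin n) ℝ) (B : Matrix (Fin m) (Fin n) ℝ)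
    (C : Matrix (Fin p) (Fin m) ℝ) (D : Matrix (Fin m) (Fin m) ℝ)
    (E : Matrix (Fin p) (Fin p) ℝ) : dspOfVec (vecG A B C D E) = dsp A B C D E := rfl

lemma exists_vecG_eq (g : GIdx n m p → ℝ) : ∃ (A : Matrix (Fin n) (Fin n) ℝ)
    (B : Matrix (Fin m) (Fin n) ℝ) (C : Matrix (Fin p) (Fin m) ℝ) (D : Matrix (Fin m) (Fin m) ℝ)
    (E : Matrix (Fin p) (Fin p) ℝ), vecG A B C D E = g := by
  refine ⟨Matrix.of fun i j => g (.inl (j, i)), Matrix.of fun i j => g (.inr (.inl (j, i))),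
    Matrix.of fun i j => g (.inr (.inr (.inl (j, i)))),
    Matrix.of fun i j => g (.inr (.inr (.inr (.inl (j, i))))),
    Matrix.of fun i j => g (.inr (.inr (.inr (.inr (j, i))))), ?_⟩
  ext c
  rcases c with c | c | c | c | c <;> rfl

lemma dspOfVec_zero : dspOfVec (0 : GIdx n m p → ℝ) = 0 := by
  ext i j
  rcases i with i | i | i <;> rcases j with j | j | j <;> simp [dspOfVec, dsp]

lemma continuous_dspOfVec : Continuous (dspOfVec : (GIdx n m p → ℝ) → _) := by
  refine continuous_matrix fun i j => ?_
  rcases i with i | i | i <;> rcases j with j | j | j <;> simp [dspOfVec, dsp] <;> fun_prop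

lemma solution_perturbation {ι : Type*} [Fintype ι] [DecidableEq ι] {M N : Matrix ι ι ℝ}
    (hM : IsUnit M.det) (hMN : IsUnit (M + N).det) (b c : ι → ℝ) :
    (M + N)⁻¹ *ᵥ (b + c) - M⁻¹ *ᵥ b = -((M + N)⁻¹ *ᵥ (N *ᵥ (M⁻¹ *ᵥ b) - c)) := by
  have h1 : M⁻¹ *ᵥ b = (M + N)⁻¹ *ᵥ ((M + N) *ᵥ (M⁻¹ *ᵥ b)) := by
    rw [mulVec_mulVec, nonsing_inv_mul _ hMN, one_mulVec]
  have h2 : (M + N) *ᵥ (M⁻¹ *ᵥ b) = b + N *ᵥ (M⁻¹ *ᵥ b) := by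
    rw [add_mulVec, mulVec_mulVec, mul_nonsing_inv _ hM, one_mulVec]
  conv_lhs => rw [h1, h2]
  rw [← mulVec_sub, ← mulVec_neg]
  congr 1
  abel

end DoubleSaddlePoint

/-- Theorem 3.2, equation (3.4): the partial normwise condition number. -/
theorem stmt3 {n m p k : ℕ}
    (A : Matrix (Fin n) (Fin n) ℝ) (B : Matrix (Fin m) (Fin n) ℝ) (C : Matrix (Fin p) (Fin m) ℝ)
    (D : Matrix (Fin m) (Fin m) ℝ) (E : Matrix (Fin p) (Fin p) ℝ)
    (hB : IsUnit (dsp A B C D E).det) (b : Idx n m p → ℝ)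
    (x : Fin n → ℝ) (y : Fin m → ℝ) (z : Fin p → ℝ)
    (hw : Sum.elim x (Sum.elim y z) = ((dsp A B C D E)⁻¹).mulVec b)
    (L : Matrix (Fin k) (Idx n m p) ℝ)
    (Ψ χ ξ : ℝ) (hΨ : 0 < Ψ) (hχ : 0 < χ) (hξ : 0 < ξ) :
    Tendsto (fun ε : ℝ => sSup {t : ℝ |
        ∃ (ΔA : Matrix (Fin n) (Fin n) ℝ) (ΔB : Matrix (Fin m) (Fin n) ℝ)
          (ΔC : Matrix (Fin p) (Fin m) ℝ) (ΔD : Matrix (Fin m) (Fin m) ℝ)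
          (ΔE : Matrix (Fin p) (Fin p) ℝ) (Δb : Idx n m p → ℝ),
          IsUnit (dsp A B C D E + dsp ΔA ΔB ΔC ΔD ΔE).det ∧
          0 < euclNorm (Sum.elim (fun c => vecG ΔA ΔB ΔC ΔD ΔE c / Ψ)
                (fun i => Δb i / χ)) ∧
          euclNorm (Sum.elim (fun c => vecG ΔA ΔB ΔC ΔD ΔE c / Ψ)
              (fun i => Δb i / χ)) ≤ ε ∧
          t = euclNorm (L.mulVec (((dsp A B C D E + dsp ΔA ΔB ΔC ΔD ΔE)⁻¹).mulVec (b + Δb))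
                - L.mulVec (((dsp A B C D E)⁻¹).mulVec b)) /
              (ξ * euclNorm (Sum.elim (fun c => vecG ΔA ΔB ΔC ΔD ΔE c / Ψ)
                (fun i => Δb i / χ)))})
      (𝓝[>] 0)
      (𝓝 (specNorm (L * (dsp A B C D E)⁻¹ *
          hcat (Ψ • calG x y z) ((-χ) • (1 : Matrix (Idx n m p) (Idx n m p) ℝ))) / ξ)) := by
  set M := dsp A B C D E
  set H := hcat (Ψ • calG x y z) ((-χ) • (1 : Matrix (Idx n m p) (Idx n m p) ℝ)) with hH
  let S : (GIdx n m p ⊕ Idx n m p → ℝ) → Matrix (Idx n m p) (Idx n m p) ℝ :=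
    fun u => M + dspOfVec (Ψ • (u ∘ Sum.inl))
  have hScont : Continuous S :=
    continuous_const.add (continuous_dspOfVec.comp (by fun_prop))
  have hS0 : S 0 = M := by
    have : Ψ • ((0 : GIdx n m p ⊕ Idx n m p → ℝ) ∘ Sum.inl) = 0 := by ext; simp
    simp only [S, this, dspOfVec_zero, add_zero]
  have hSinv : ContinuousAt (fun u => (S u)⁻¹) 0 := by
    refine ContinuousAt.comp (g := Inv.inv) ?_ hScont.continuousAt
    refine continuousAt_matrix_inv _ ?_
    rw [hS0, Ring.inverse_eq_inv']
    exact continuousAt_inv₀ hB.ne_zero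
  have hF : ContinuousAt (fun u => L * (S u)⁻¹ * H) 0 := by
    have hmul : Continuous fun N : Matrix (Idx n m p) (Idx n m p) ℝ => L * N * H := by fun_prop
    exact hmul.continuousAt.comp hSinv
  have hP : ∀ᶠ u in 𝓝 0, IsUnit (S u).det := by
    have : ∀ᶠ u in 𝓝 0, (S u).det ≠ 0 :=
      hScont.matrix_det.continuousAt.eventually_ne (by rw [hS0]; exact hB.ne_zero)
    filter_upwards [this] with u hu using hu.isUnit
  have key := tendsto_sSup_euclNorm_mulVec_div hF hP hξ
  simp only [hS0] at key
  refine key.congr fun ε => ?_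
  congr 1
  have hΨS : ∀ ΔA ΔB ΔC ΔD ΔE (Δb : Idx n m p → ℝ),
      S (Sum.elim (fun c => vecG ΔA ΔB ΔC ΔD ΔE c / Ψ) (fun i => Δb i / χ)) =
        M + dsp ΔA ΔB ΔC ΔD ΔE := by
    intro ΔA ΔB ΔC ΔD ΔE Δb
    simp only [S, Sum.elim_comp_inl, smul_div_cancel_of_pos hΨ, dspOfVec_vecG]
  have hval : ∀ ΔA ΔB ΔC ΔD ΔE (Δb : Idx n m p → ℝ), IsUnit (M + dsp ΔA ΔB ΔC ΔD ΔE).det →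
      euclNorm (L *ᵥ ((M + dsp ΔA ΔB ΔC ΔD ΔE)⁻¹ *ᵥ (b + Δb)) - L *ᵥ (M⁻¹ *ᵥ b)) =
        euclNorm ((L * (M + dsp ΔA ΔB ΔC ΔD ΔE)⁻¹ * H) *ᵥ
          Sum.elim (fun c => vecG ΔA ΔB ΔC ΔD ΔE c / Ψ) (fun i => Δb i / χ)) := by
    intro ΔA ΔB ΔC ΔD ΔE Δb hu
    have hHu : H *ᵥ Sum.elim (fun c => vecG ΔA ΔB ΔC ΔD ΔE c / Ψ) (fun i => Δb i / χ) =
        dsp ΔA ΔB ΔC ΔD ΔE *ᵥ (M⁻¹ *ᵥ b) - Δb := by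
      rw [hH, hcat_mulVec, smul_mulVec, smul_mulVec, one_mulVec, ← mulVec_smul, smul_div_cancel_of_pos hΨ, neg_smul,
        smul_div_cancel_of_pos hχ, ← hw, dsp_mulVec, sub_eq_add_neg]
    rw [← mulVec_sub, solution_perturbation hB hu, mulVec_neg, euclNorm_neg, ← hHu,
      mulVec_mulVec, mulVec_mulVec, Matrix.mul_assoc]
  ext t
  constructor
  · rintro ⟨u, hu, hu0, huε, rfl⟩
    obtain ⟨ΔA, ΔB, ΔC, ΔD, ΔE, hg⟩ := exists_vecG_eq (Ψ • (u ∘ Sum.inl))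
    have hu' : Sum.elim (fun c => vecG ΔA ΔB ΔC ΔD ΔE c / Ψ)
        (fun i => (χ • (u ∘ Sum.inr)) i / χ) = u := by
      ext c
      rcases c with c | c <;> simp [hg, mul_div_cancel_left₀, hΨ.ne', hχ.ne']
    have hSu := hΨS ΔA ΔB ΔC ΔD ΔE (χ • (u ∘ Sum.inr))
    rw [hu'] at hSu
    refine ⟨ΔA, ΔB, ΔC, ΔD, ΔE, χ • (u ∘ Sum.inr), hSu ▸ hu, ?_⟩
    rw [hval _ _ _ _ _ _ (hSu ▸ hu), hu', hSu]
    exact ⟨hu0, huε, rfl⟩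
  · rintro ⟨ΔA, ΔB, ΔC, ΔD, ΔE, Δb, hu, hu0, huε, rfl⟩
    refine ⟨_, ?_, hu0, huε, ?_⟩
    · rwa [hΨS]
    · rw [hval _ _ _ _ _ _ hu, hΨS]

end
end

section
/- Let 𝔅 be nonsingular, b ∈ ℝ^l, w = [x; y; z] = 𝔅^{-1}b, L ∈ ℝ^{k×l}. Let ξ ∈ ℝ^k, χ ∈ ℝ^l and a tuple Ψ = (Ψ_A, Ψ_B, Ψ_C, Ψ_D, Ψ_E) of matrices of the same sizes as (A,B,C,D,E), all with every entry nonzero. For ε > 0 let S(ε) be the supremum of ‖ ξ‡ ⊙ ( L(𝔅+Δ𝔅)^{-1}(b+Δb) − L𝔅^{-1}b ) ‖_∞ / ‖ [vec(Ψ_A‡⊙ΔA); vec(Ψ_B‡⊙ΔB); vec(Ψ_C‡⊙ΔC); vec(Ψ_D‡⊙ΔD); vec(Ψ_E‡⊙ΔE); χ‡⊙Δb] ‖_∞ over all perturbations ΔA, ΔB, ΔC, ΔD, ΔE, Δb of matching sizes for which Δ𝔅 = [[ΔA, ΔBᵀ, 0],[ΔB, −ΔD, ΔCᵀ],[0, ΔC,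 ΔE]] makes 𝔅+Δ𝔅 nonsingular and the perturbation measure in the denominator lies in (0, ε]. Then S(ε) tends, as ε → 0⁺, to ‖ |Θ_{ξ‡}| · |L·𝔅^{-1}·[𝒢, −I_l]| · [vec(|Ψ_A|); vec(|Ψ_B|); vec(|Ψ_C|); vec(|Ψ_D|); vec(|Ψ_E|); |χ|] ‖_∞. -/
open Matrix Filter Topology

noncomputable section

section Helpers

theorem infNormV_eq_norm {ι : Type*} [Fintype ι] (v : ι → ℝ) : infNormV v = ‖v‖ := by
  refine le_antisymm (Real.iSup_le (fun i => norm_le_pi_norm v i) (norm_nonneg v)) ?_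
  exact (pi_norm_le_iff_of_nonneg (Real.iSup_nonneg fun i => abs_nonneg (v i))).2 fun i =>
    le_ciSup (f := fun i => |v i|) (Set.finite_range _).bddAbove i

/-- The relative response of a map that vanishes and is differentiable at the origin, maximized
over perturbations of size at most `ε`, tends to the operator norm of its derivative. -/
theorem tendsto_sSup_norm_div_norm {V W : Type*} [NormedAddCommGroup V] [NormedSpace ℝ V]
    [NormedAddCommGroup W] [NormedSpace ℝ W] {P : V → Prop} {f : V → W} {f' : V →L[ℝ] W}
    (hP : ∀ᶠ u in 𝓝 0, P u) (hf : ∀ δ > 0, ∀ᶠ u in 𝓝 0, ‖f u - f' u‖ ≤ δ * ‖u‖) :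
    Tendsto (fun ε : ℝ => sSup {t : ℝ | ∃ u, P u ∧ 0 < ‖u‖ ∧ ‖u‖ ≤ ε ∧ t = ‖f u‖ / ‖u‖})
      (𝓝[>] 0) (𝓝 ‖f'‖) := by
  rw [Metric.tendsto_nhds]
  intro δ hδ
  obtain ⟨r, hr, hball⟩ := Metric.eventually_nhds_iff.1 (hP.and (hf (δ / 2) (half_pos hδ)))
  filter_upwards [Ioo_mem_nhdsGT hr] with ε ⟨hε, hεr⟩
  have near : ∀ u : V, ‖u‖ ≤ ε → P u ∧ ‖f u - f' u‖ ≤ δ / 2 * ‖u‖ := fun u hu =>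
    hball (by simpa using hu.trans_lt hεr)
  set S := {t : ℝ | ∃ u, P u ∧ 0 < ‖u‖ ∧ ‖u‖ ≤ ε ∧ t = ‖f u‖ / ‖u‖} with hS
  have ub : ∀ t ∈ S, t ≤ ‖f'‖ + δ / 2 := by
    rintro t ⟨u, -, hu, huε, rfl⟩
    rw [div_le_iff₀ hu]
    have h1 := (near u huε).2
    have h2 := f'.le_opNorm u
    have h3 := norm_le_norm_add_norm_sub' (f u) (f' u)
    linarith
  have hle : sSup S ≤ ‖f'‖ + δ / 2 := Real.sSup_le ub (by positivity)
  have hnonneg : 0 ≤ sSup S := Real.sSup_nonneg (by rintro t ⟨u, -, -, -, rfl⟩; positivity)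
  have hge : ‖f'‖ ≤ sSup S + δ / 2 := by
    refine f'.opNorm_le_bound (by positivity) fun v => ?_
    rcases eq_or_ne v 0 with rfl | hv
    · simp
    have hv' : 0 < ‖v‖ := norm_pos_iff.2 hv
    set c := ε / ‖v‖
    have hc : 0 < c := div_pos hε hv'
    have hcv : ‖c • v‖ = ε := by
      rw [norm_smul, Real.norm_of_nonneg hc.le, div_mul_cancel₀ _ hv'.ne']
    obtain ⟨hPu, hu⟩ := near (c • v) hcv.le
    have hmem : ‖f (c • v)‖ / ‖c • v‖ ≤ sSup S :=
      le_csSup ⟨_, ub⟩ ⟨c • v, hPu, by rw [hcv]; exact hε, hcv.le, rfl⟩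
    rw [div_le_iff₀ (by rw [hcv]; exact hε)] at hmem
    have h3 := norm_le_norm_add_norm_sub (f (c • v)) (f' (c • v))
    have h4 : ‖f' (c • v)‖ = c * ‖f' v‖ := by
      rw [map_smul, norm_smul, Real.norm_of_nonneg hc.le]
    have h5 : ‖c • v‖ = c * ‖v‖ := by rw [norm_smul, Real.norm_of_nonneg hc.le]
    rw [h4] at h3
    rw [h5] at hmem hu
    refine le_of_mul_le_mul_left ?_ hc
    linarith
  rw [Real.dist_eq, abs_lt]
  constructor <;> linarith

open scoped Matrix.Norms.Operator in
/-- For a response `u ↦ M u *ᵥ u` with `M` continuous at the origin, the maximal relative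
response in the max-norm tends to the maximal absolute row sum of `M 0`. -/
theorem tendsto_sSup_infNormV_mulVec {ι κ : Type*} [Fintype ι] [Fintype κ]
    {P : (κ → ℝ) → Prop} {M : (κ → ℝ) → Matrix ι κ ℝ} (hP : ∀ᶠ u in 𝓝 0, P u)
    (hM : ContinuousAt M 0) :
    Tendsto (fun ε : ℝ => sSup {t : ℝ | ∃ u, P u ∧ 0 < infNormV u ∧ infNormV u ≤ ε ∧
        t = infNormV (M u *ᵥ u) / infNormV u})
      (𝓝[>] 0) (𝓝 (infNormV fun i => ∑ j, |M 0 i j|)) := by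
  have hnorm : (infNormV fun i => ∑ j, |M 0 i j|) =
      ‖(⟨(M 0).mulVecLin, (M 0).mulVecLin.continuous_of_finiteDimensional⟩ :
        (κ → ℝ) →L[ℝ] (ι → ℝ))‖ := by
    rw [← Matrix.linfty_opNorm_eq_opNorm, infNormV_eq_norm, Matrix.linfty_opNorm_def,
      Pi.norm_def]
    congr 2
    ext i
    simp [Finset.abs_sum_of_nonneg]
  simp only [hnorm, infNormV_eq_norm]
  refine tendsto_sSup_norm_div_norm hP fun δ hδ => ?_
  filter_upwards [hM.eventually (Metric.closedBall_mem_nhds (M 0) hδ)] with u hu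
  have h : ‖M u - M 0‖ ≤ δ := by simpa [dist_eq_norm] using hu
  calc ‖M u *ᵥ u - M 0 *ᵥ u‖ = ‖(M u - M 0) *ᵥ u‖ := by rw [Matrix.sub_mulVec]
    _ ≤ ‖M u - M 0‖ * ‖u‖ := Matrix.linfty_opNorm_mulVec _ _
    _ ≤ δ * ‖u‖ := by gcongr

theorem calG_mulVec_vecG {n m p : ℕ} (x : Fin n → ℝ) (y : Fin m → ℝ) (z : Fin p → ℝ)
    (A : Matrix (Fin n) (Fin n) ℝ) (B : Matrix (Fin m) (Fin n) ℝ)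
    (C : Matrix (Fin p) (Fin m) ℝ) (D : Matrix (Fin m) (Fin m) ℝ)
    (E : Matrix (Fin p) (Fin p) ℝ) :
    calG x y z *ᵥ vecG A B C D E = dsp A B C D E *ᵥ Sum.elim x (Sum.elim y z) := by
  ext (i | i | i) <;>
    simp [Matrix.mulVec, dotProduct, Fintype.sum_sum_type, Fintype.sum_prod_type, calG, vecG, vecC,
      dsp, mul_comm, add_comm]

theorem hcat_mulVec_elim {a b c : Type*} [Fintype b] [Fintype c] (M : Matrix a b ℝ)
    (N : Matrix a c ℝ) (u : b → ℝ) (v : c → ℝ) :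
    hcat M N *ᵥ Sum.elim u v = M *ᵥ u + N *ᵥ v := by
  ext i
  simp [Matrix.mulVec, dotProduct, hcat]

/-- The solution error of a perturbed linear system. -/
theorem inv_mulVec_sub_inv_mulVec {ι : Type*} [Fintype ι] [DecidableEq ι] {M N : Matrix ι ι ℝ}
    (hM : IsUnit M.det) (hMN : IsUnit (M + N).det) (b d : ι → ℝ) :
    (M + N)⁻¹ *ᵥ (b + d) - M⁻¹ *ᵥ b = (M + N)⁻¹ *ᵥ (d - N *ᵥ (M⁻¹ *ᵥ b)) := by
  have h1 : M⁻¹ *ᵥ b = (M + N)⁻¹ *ᵥ ((M + N) *ᵥ (M⁻¹ *ᵥ b)) := by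
    rw [Matrix.mulVec_mulVec (M⁻¹ *ᵥ b), Matrix.nonsing_inv_mul _ hMN, Matrix.one_mulVec]
  have h2 : M *ᵥ (M⁻¹ *ᵥ b) = b := by
    rw [Matrix.mulVec_mulVec, Matrix.mul_nonsing_inv _ hM, Matrix.one_mulVec]
  conv_lhs => rw [h1, ← Matrix.mulVec_sub, Matrix.add_mulVec, h2]
  congr 1
  abel

/-- The matrix whose scaled vectorization by the weights `Ψ` is `v`. -/
def unscale {q r : ℕ} (Ψ : Matrix (Fin q) (Fin r) ℝ) (v : Fin r × Fin q → ℝ) :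
    Matrix (Fin q) (Fin r) ℝ :=
  Matrix.of fun i j => Ψ i j * v (j, i)

/-- The double saddle point perturbation whose scaled vectorization by the weights is `v`. -/
def unscaleDsp {n m p : ℕ} (ΨA : Matrix (Fin n) (Fin n) ℝ) (ΨB : Matrix (Fin m) (Fin n) ℝ)
    (ΨC : Matrix (Fin p) (Fin m) ℝ) (ΨD : Matrix (Fin m) (Fin m) ℝ)
    (ΨE : Matrix (Fin p) (Fin p) ℝ) (v : GIdx n m p → ℝ) : Matrix (Idx n m p) (Idx n m p) ℝ :=
  dsp (unscale ΨA fun c => v (.inl c)) (unscale ΨB fun c => v (.inr (.inl c)))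
    (unscale ΨC fun c => v (.inr (.inr (.inl c))))
    (unscale ΨD fun c => v (.inr (.inr (.inr (.inl c)))))
    (unscale ΨE fun c => v (.inr (.inr (.inr (.inr c)))))

variable {n m p : ℕ} (ΨA : Matrix (Fin n) (Fin n) ℝ) (ΨB : Matrix (Fin m) (Fin n) ℝ)
  (ΨC : Matrix (Fin p) (Fin m) ℝ) (ΨD : Matrix (Fin m) (Fin m) ℝ)
  (ΨE : Matrix (Fin p) (Fin p) ℝ) (χ : Idx n m p → ℝ)

theorem unscale_inv_mul {q r : ℕ} {Ψ : Matrix (Fin q) (Fin r) ℝ} (hΨ : ∀ i j, Ψ i j ≠ 0)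
    (X : Matrix (Fin q) (Fin r) ℝ) : unscale Ψ (fun c => (Ψ c.2 c.1)⁻¹ * X c.2 c.1) = X := by
  ext i j
  simp [unscale, hΨ]

theorem unscaleDsp_zero : unscaleDsp ΨA ΨB ΨC ΨD ΨE 0 = 0 := by
  ext (i | i | i) (j | j | j) <;> simp [unscaleDsp, unscale, dsp]

theorem continuous_unscaleDsp : Continuous (unscaleDsp ΨA ΨB ΨC ΨD ΨE) := by
  refine continuous_matrix ?_
  rintro (i | i | i) (j | j | j) <;> simp only [unscaleDsp, unscale, dsp, Matrix.of_apply,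
    Matrix.transpose_apply] <;> fun_prop

theorem calG_mulVec_scaled (x : Fin n → ℝ) (y : Fin m → ℝ) (z : Fin p → ℝ)
    (v : GIdx n m p → ℝ) :
    calG x y z *ᵥ (vecG ΨA ΨB ΨC ΨD ΨE * v) =
      unscaleDsp ΨA ΨB ΨC ΨD ΨE v *ᵥ Sum.elim x (Sum.elim y z) := by
  rw [unscaleDsp, ← calG_mulVec_vecG]
  congr 1
  ext (c | c | c | c | c) <;> rfl

/-- Unscaling is a bijection, so perturbations may be parametrized by their scaled vectors. -/
theorem exists_scaledPert_iff (hΨA : ∀ i j, ΨA i j ≠ 0) (hΨB : ∀ i j, ΨB i j ≠ 0)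
    (hΨC : ∀ i j, ΨC i j ≠ 0) (hΨD : ∀ i j, ΨD i j ≠ 0) (hΨE : ∀ i j, ΨE i j ≠ 0)
    (hχ : ∀ i, χ i ≠ 0)
    (Q : Matrix (Idx n m p) (Idx n m p) ℝ → (Idx n m p → ℝ) →
      (GIdx n m p ⊕ Idx n m p → ℝ) → Prop) :
    (∃ ΔA ΔB ΔC ΔD ΔE Δb, Q (dsp ΔA ΔB ΔC ΔD ΔE) Δb
      (scaledPert ΨA ΨB ΨC ΨD ΨE χ ΔA ΔB ΔC ΔD ΔE Δb)) ↔
    ∃ u : GIdx n m p ⊕ Idx n m p → ℝ,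
      Q (unscaleDsp ΨA ΨB ΨC ΨD ΨE (u ∘ Sum.inl)) (χ * u ∘ Sum.inr) u := by
  constructor
  · rintro ⟨ΔA, ΔB, ΔC, ΔD, ΔE, Δb, h⟩
    refine ⟨scaledPert ΨA ΨB ΨC ΨD ΨE χ ΔA ΔB ΔC ΔD ΔE Δb, ?_⟩
    convert h using 1
    · simp only [unscaleDsp, scaledPert, vecG, vecC, Function.comp_apply, Sum.elim_inl,
        Sum.elim_inr, unscale_inv_mul hΨA, unscale_inv_mul hΨB, unscale_inv_mul hΨC,
        unscale_inv_mul hΨD, unscale_inv_mul hΨE]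
    · ext i
      simp [scaledPert, hχ]
  · rintro ⟨u, h⟩
    refine ⟨unscale ΨA fun c => u (.inl (.inl c)), unscale ΨB fun c => u (.inl (.inr (.inl c))),
      unscale ΨC fun c => u (.inl (.inr (.inr (.inl c)))),
      unscale ΨD fun c => u (.inl (.inr (.inr (.inr (.inl c))))),
      unscale ΨE fun c => u (.inl (.inr (.inr (.inr (.inr c))))), χ * u ∘ Sum.inr, ?_⟩
    convert h using 1
    · rfl
    · ext ((c | c | c | c | c) | i) <;>
        simp [scaledPert, vecG, vecC, unscale, hΨA, hΨB, hΨC, hΨD, hΨE, hχ]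

end Helpers

/-- Theorem 3.3, ∞-norm unified partial condition number. -/
theorem stmt7 {n m p k : ℕ}
    (A : Matrix (Fin n) (Fin n) ℝ) (B : Matrix (Fin m) (Fin n) ℝ) (C : Matrix (Fin p) (Fin m) ℝ)
    (D : Matrix (Fin m) (Fin m) ℝ) (E : Matrix (Fin p) (Fin p) ℝ)
    (hB : IsUnit (dsp A B C D E).det) (b : Idx n m p → ℝ)
    (x : Fin n → ℝ) (y : Fin m → ℝ) (z : Fin p → ℝ)
    (hw : Sum.elim x (Sum.elim y z) = ((dsp A B C D E)⁻¹).mulVec b)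
    (L : Matrix (Fin k) (Idx n m p) ℝ)
    (ξ : Fin k → ℝ) (hξ : ∀ i, ξ i ≠ 0) (χ : Idx n m p → ℝ) (hχ : ∀ i, χ i ≠ 0)
    (ΨA : Matrix (Fin n) (Fin n) ℝ) (hΨA : ∀ i j, ΨA i j ≠ 0)
    (ΨB : Matrix (Fin m) (Fin n) ℝ) (hΨB : ∀ i j, ΨB i j ≠ 0)
    (ΨC : Matrix (Fin p) (Fin m) ℝ) (hΨC : ∀ i j, ΨC i j ≠ 0)
    (ΨD : Matrix (Fin m) (Fin m) ℝ) (hΨD : ∀ i j, ΨD i j ≠ 0)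
    (ΨE : Matrix (Fin p) (Fin p) ℝ) (hΨE : ∀ i j, ΨE i j ≠ 0) :
    Tendsto (fun ε : ℝ => sSup {t : ℝ |
        ∃ (ΔA : Matrix (Fin n) (Fin n) ℝ) (ΔB : Matrix (Fin m) (Fin n) ℝ)
          (ΔC : Matrix (Fin p) (Fin m) ℝ) (ΔD : Matrix (Fin m) (Fin m) ℝ)
          (ΔE : Matrix (Fin p) (Fin p) ℝ) (Δb : Idx n m p → ℝ),
          IsUnit (dsp A B C D E + dsp ΔA ΔB ΔC ΔD ΔE).det ∧
          0 < infNormV (scaledPert ΨA ΨB ΨC ΨD ΨE χ ΔA ΔB ΔC ΔD ΔE Δb) ∧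
          infNormV (scaledPert ΨA ΨB ΨC ΨD ΨE χ ΔA ΔB ΔC ΔD ΔE Δb) ≤ ε ∧
          t = infNormV (fun i => (ξ i)⁻¹ *
                (L.mulVec (((dsp A B C D E + dsp ΔA ΔB ΔC ΔD ΔE)⁻¹).mulVec (b + Δb)) i
                  - L.mulVec (((dsp A B C D E)⁻¹).mulVec b) i)) /
              infNormV (scaledPert ΨA ΨB ΨC ΨD ΨE χ ΔA ΔB ΔC ΔD ΔE Δb)})
      (𝓝[>] 0)
      (𝓝 (infNormV ((absM (Matrix.diagonal (fun i => (ξ i)⁻¹))).mulVec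
          ((absM (L * (dsp A B C D E)⁻¹ *
              hcat (calG x y z) (-1 : Matrix (Idx n m p) (Idx n m p) ℝ))).mulVec
            (Sum.elim (vecG (absM ΨA) (absM ΨB) (absM ΨC) (absM ΨD) (absM ΨE))
              (absV χ)))))) := by
  set H := hcat (calG x y z) (-1 : Matrix (Idx n m p) (Idx n m p) ℝ) with hH
  set M := dsp A B C D E with hM
  set N := fun u : GIdx n m p ⊕ Idx n m p → ℝ => unscaleDsp ΨA ΨB ΨC ΨD ΨE (u ∘ Sum.inl) with hN
  have hN0 : N 0 = 0 := unscaleDsp_zero ..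
  have hNcont : Continuous N := (continuous_unscaleDsp ..).comp (by fun_prop)
  have hMN : ContinuousAt (fun u => M + N u) 0 := by fun_prop
  set R := fun u => Matrix.diagonal (fun i => (ξ i)⁻¹) * (L * (M + N u)⁻¹ * H) *
    Matrix.diagonal (-Sum.elim (vecG ΨA ΨB ΨC ΨD ΨE) χ) with hR
  have hPev : ∀ᶠ u in 𝓝 0, IsUnit (M + N u).det := by
    have hdet : ContinuousAt (fun u => (M + N u).det) 0 :=
      (continuous_const.add hNcont).matrix_det.continuousAt
    filter_upwards [hdet.eventually_ne (y := 0) (by simpa [hN0] using hB.ne_zero)] with u hu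
    exact hu.isUnit
  have hRcont : ContinuousAt R 0 := by
    have hinv : ContinuousAt (fun u => (M + N u)⁻¹) 0 :=
      ContinuousAt.comp (g := fun X : Matrix (Idx n m p) (Idx n m p) ℝ => X⁻¹)
        (continuousAt_matrix_inv _ (by
          rw [Ring.inverse_eq_inv']
          exact continuousAt_inv₀ (by simpa [hN0] using hB.ne_zero))) hMN
    exact ((continuous_const.matrix_mul ((continuous_const.matrix_mul continuous_id).matrix_mul
      continuous_const)).matrix_mul continuous_const).continuousAt.comp hinv
  have hresp : ∀ u, IsUnit (M + N u).det → R u *ᵥ u = fun i => (ξ i)⁻¹ *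
      ((L *ᵥ ((M + N u)⁻¹ *ᵥ (b + χ * u ∘ Sum.inr))) i - (L *ᵥ (M⁻¹ *ᵥ b)) i) := by
    intro u hu
    have hHu : H *ᵥ (Matrix.diagonal (-Sum.elim (vecG ΨA ΨB ΨC ΨD ΨE) χ) *ᵥ u) =
        χ * u ∘ Sum.inr - N u *ᵥ (M⁻¹ *ᵥ b) := by
      have hdiag : Matrix.diagonal (-Sum.elim (vecG ΨA ΨB ΨC ΨD ΨE) χ) *ᵥ u =
          -Sum.elim (vecG ΨA ΨB ΨC ΨD ΨE * u ∘ Sum.inl) (χ * u ∘ Sum.inr) := by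
        ext (c | i) <;> simp [Matrix.mulVec_diagonal]
      rw [hdiag, Matrix.mulVec_neg, hH, hcat_mulVec_elim, calG_mulVec_scaled, hw,
        Matrix.neg_mulVec, Matrix.one_mulVec]
      abel
    ext i
    rw [← Pi.sub_apply (L *ᵥ _), ← Matrix.mulVec_sub, inv_mulVec_sub_inv_mulVec hB hu, ← hHu]
    simp only [hR, ← Matrix.mulVec_mulVec, Matrix.mulVec_diagonal]
  have hlim := tendsto_sSup_infNormV_mulVec hPev hRcont
  convert hlim using 3 with ε
  · congr 1
    ext t
    refine (exists_scaledPert_iff ΨA ΨB ΨC ΨD ΨE χ hΨA hΨB hΨC hΨD hΨE hχ fun Δ Δb u =>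
      IsUnit (M + Δ).det ∧ 0 < infNormV u ∧ infNormV u ≤ ε ∧
        t = infNormV (fun i => (ξ i)⁻¹ *
          ((L *ᵥ ((M + Δ)⁻¹ *ᵥ (b + Δb))) i - (L *ᵥ (M⁻¹ *ᵥ b)) i)) / infNormV u).trans ?_
    refine exists_congr fun u => and_congr_right fun hu => ?_
    rw [hresp u hu]
  · ext i
    have habs : absM (Matrix.diagonal fun i => (ξ i)⁻¹) = Matrix.diagonal fun i => |(ξ i)⁻¹| := by
      ext i j
      rcases eq_or_ne i j with rfl | hij <;> simp [absM, *]
    rw [habs, Matrix.mulVec_diagonal]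
    simp only [hR, hN0, add_zero, Matrix.mul_diagonal, Matrix.diagonal_mul, abs_mul,
      Matrix.mulVec, dotProduct, Finset.mul_sum]
    refine Finset.sum_congr rfl fun c _ => ?_
    rw [mul_assoc]
    rcases c with (c | c | c | c | c) | c <;> simp [absM, absV, vecG, vecC]

end
end
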